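/- Let n ≥ 1, p ∈ {0, 1}, and let B_{p,n} = { φ ∈ C^n(ℝ) : ‖φ^{(k)}‖_∞ ≤ 1 for all p ≤ k ≤ n }. For real random variables X and Y define d_W^{p,n}(X,Y) = sup_{φ ∈ B_{p,n}} E[φ(X) − φ(Y)] and d_c^{p,n}(X,Y) = sup_{φ ∈ B_{p,n} ∩ C_c^∞(ℝ)} E[φ(X) − φ(Y)], where C_c^∞(ℝ) is the space of smooth compactly supported functions (suprema taken in [0,∞]). If X and Y admit finite moments of order p, then d_W^{p,n}(X,Y) = d_c^{p,n}(X,Y). -/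

import Mathlib

open MeasureTheory ProbabilityTheory

open Filter Topology
section SmoothApproximation

open scoped ContDiff Convolution

theorem HasCompactSupport.iteratedDeriv_convolution_right {f g : ℝ → ℝ} {k : ℕ}
    (hf : LocallyIntegrable f) (hcg : HasCompactSupport g) (hg : ContDiff ℝ k g) :
    iteratedDeriv k (f ⋆[ContinuousLinearMap.lsmul ℝ ℝ] g) =
      f ⋆[ContinuousLinearMap.lsmul ℝ ℝ] iteratedDeriv k g := by
  induction k generalizing g with
  | zero => simp
  | succ k ih =>
    have hderiv : deriv (f ⋆[ContinuousLinearMap.lsmul ℝ ℝ] g) =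
        f ⋆[ContinuousLinearMap.lsmul ℝ ℝ] deriv g := funext fun x =>
      (hcg.hasDerivAt_convolution_right _ hf (hg.of_le (by exact_mod_cast Nat.le_add_left 1 k))
        x).deriv
    rw [iteratedDeriv_succ', iteratedDeriv_succ', hderiv]
    exact ih hcg.deriv (contDiff_succ_iff_deriv.1 (by exact_mod_cast hg)).2.2

/-- Iterated derivatives of positive order of a bump function vanish away from the annulus
between its inner and its outer radius. -/
theorem ContDiffBump.iteratedDeriv_eq_zero (η : ContDiffBump (0 : ℝ)) {k : ℕ} (hk : k ≠ 0)
    {x : ℝ} (hx : |x| < η.rIn ∨ η.rOut < |x|) : iteratedDeriv k η x = 0 := by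
  rcases hx with hx | hx
  · rw [(η.eventuallyEq_one_of_mem_ball (by simpa using hx)).iteratedDeriv_eq]
    exact (iteratedDeriv_const (c := (1 : ℝ))).trans (if_neg hk)
  · have h : (η : ℝ → ℝ) =ᶠ[𝓝 x] fun _ => 0 := by
      filter_upwards [(isOpen_lt continuous_const continuous_abs).mem_nhds hx] with y hy
      exact η.zero_of_le_dist (by simpa using hy.le)
    rw [h.iteratedDeriv_eq, iteratedDeriv_fun_const_zero]

/-- Smooth cutoff functions all of whose derivatives decay faster than `ε / (1 + |x|)`. -/
theorem exists_contDiff_cutoff (n : ℕ) {ε : ℝ} (hε : 0 < ε) (R : ℝ) :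
    ∃ χ : ℝ → ℝ, ContDiff ℝ ∞ χ ∧ HasCompactSupport χ ∧ (∀ x, 0 ≤ χ x) ∧ (∀ x, χ x ≤ 1) ∧
      (∀ x, |x| ≤ R → χ x = 1) ∧
      ∀ k, k ≠ 0 → k ≤ n → ∀ x, (1 + |x|) * |iteratedDeriv k χ x| ≤ ε := by
  let η : ContDiffBump (0 : ℝ) := ⟨1, 2, one_pos, one_lt_two⟩
  obtain ⟨C, hC0, hC⟩ : ∃ C, 0 ≤ C ∧ ∀ k, k ≠ 0 → k ≤ n → ∀ y, |iteratedDeriv k η y| ≤ C := by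
    have hb (k : ℕ) : ∃ C, 0 ≤ C ∧ (k ≠ 0 → ∀ y, |iteratedDeriv k η y| ≤ C) := by
      rcases eq_or_ne k 0 with rfl | hk
      · exact ⟨0, le_rfl, fun h => absurd rfl h⟩
      have hc : HasCompactSupport (iteratedDeriv k η) :=
        .of_support_subset_isCompact (isCompact_closedBall (0 : ℝ) 2) fun y hy => by
          by_contra hy'
          exact hy (η.iteratedDeriv_eq_zero hk (.inr (by simpa using! hy')))
      obtain ⟨C, hC⟩ := hc.exists_bound_of_continuous
        ((η.contDiff (n := (k : ℕ∞))).continuous_iteratedDeriv' k)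
      exact ⟨C, (norm_nonneg _).trans (hC 0), fun _ => hC⟩
    choose B hB0 hB using hb
    refine ⟨∑ k ∈ Finset.range (n + 1), B k, Finset.sum_nonneg fun k _ => hB0 k,
      fun k hk hkn y => (hB k hk y).trans ?_⟩
    exact Finset.single_le_sum (f := B) (fun i _ => hB0 i) (by simpa using Nat.lt_succ_of_le hkn)
  obtain ⟨N, hN⟩ := exists_nat_gt (3 * C / ε)
  have hN0 : (0 : ℝ) < N := lt_of_le_of_lt (by positivity) hN
  set S : ℝ := max R 1
  have hS : 1 ≤ S := le_max_right _ _
  let r : ℕ → ℝ := fun i => S * 3 ^ i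
  have hr1 (i : ℕ) : 1 ≤ r i := one_le_mul_of_one_le_of_one_le hS (one_le_pow₀ (by norm_num))
  have hr0 (i : ℕ) : 0 < r i := one_pos.trans_le (hr1 i)
  have hrS (i : ℕ) : S ≤ r i := le_mul_of_one_le_right (by linarith) (one_le_pow₀ (by norm_num))
  have hrlt {i j : ℕ} (hij : i < j) : 3 * r i ≤ r j := by
    have : (3 : ℝ) ^ (i + 1) ≤ 3 ^ j := pow_le_pow_right₀ (by norm_num) hij
    calc 3 * r i = S * 3 ^ (i + 1) := by simp only [r]; ring
      _ ≤ r j := by simp only [r]; gcongr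
  have hsmooth (i : ℕ) : ContDiff ℝ ∞ fun x => η ((r i)⁻¹ * x) :=
    η.contDiff.comp (contDiff_const.mul contDiff_id)
  refine ⟨fun x => (N : ℝ)⁻¹ * ∑ i ∈ Finset.range N, η ((r i)⁻¹ * x),
    contDiff_const.mul (ContDiff.sum fun i _ => hsmooth i), ?_, fun x => ?_, fun x => ?_,
    fun x hx => ?_, fun k hk hkn x => ?_⟩
  · refine HasCompactSupport.of_support_subset_isCompact
      (isCompact_closedBall (0 : ℝ) (2 * r N)) fun x hx => ?_
    by_contra hx'
    refine hx ?_
    have hx2 : 2 * r N < |x| := by simpa using hx'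
    refine mul_eq_zero_of_right _ (Finset.sum_eq_zero fun i hi => η.zero_of_le_dist ?_)
    have := hrlt (Finset.mem_range.1 hi)
    rw [dist_zero_right, Real.norm_eq_abs, abs_mul, abs_of_pos (inv_pos.2 (hr0 i)),
      ← div_eq_inv_mul, le_div_iff₀ (hr0 i)]
    change 2 * r i ≤ |x|
    linarith [hr0 i]
  · exact mul_nonneg (by positivity) (Finset.sum_nonneg fun i _ => η.nonneg)
  · refine (div_eq_inv_mul _ _).symm.trans_le ((div_le_one hN0).2 ?_)
    calc ∑ i ∈ Finset.range N, η ((r i)⁻¹ * x) ≤ ∑ i ∈ Finset.range N, (1 : ℝ) :=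
          Finset.sum_le_sum fun i _ => η.le_one
      _ = N := by simp
  · have : ∀ i ∈ Finset.range N, η ((r i)⁻¹ * x) = 1 := fun i _ => by
      refine η.one_of_mem_closedBall ?_
      rw [mem_closedBall_zero_iff, Real.norm_eq_abs, abs_mul, abs_of_pos (inv_pos.2 (hr0 i)),
        ← div_eq_inv_mul, div_le_iff₀ (hr0 i)]
      change |x| ≤ 1 * r i
      linarith [hrS i, le_max_left R 1]
    simp [Finset.sum_congr rfl this, hN0.ne']
  · set a : ℕ → ℝ := fun i => (r i)⁻¹ ^ k * iteratedDeriv k η ((r i)⁻¹ * x) with ha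
    have hsum : iteratedDeriv k (fun x => (N : ℝ)⁻¹ * ∑ i ∈ Finset.range N, η ((r i)⁻¹ * x)) x =
        (N : ℝ)⁻¹ * ∑ i ∈ Finset.range N, a i := by
      rw [iteratedDeriv_const_mul_field, iteratedDeriv_fun_sum fun i _ =>
        ((hsmooth i).of_le (by exact_mod_cast le_top)).contDiffAt]
      congr 1
      refine Finset.sum_congr rfl fun i _ => ?_
      rw [iteratedDeriv_comp_const_mul (η.contDiff (n := (k : ℕ∞)))]
    have hannulus {i : ℕ} (hi : a i ≠ 0) : r i ≤ |x| ∧ |x| ≤ 2 * r i := by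
      by_contra h
      refine hi (mul_eq_zero_of_right _ (η.iteratedDeriv_eq_zero hk ?_))
      rw [abs_mul, abs_of_pos (inv_pos.2 (hr0 i)), ← div_eq_inv_mul, div_lt_iff₀ (hr0 i),
        lt_div_iff₀ (hr0 i)]
      change |x| < 1 * r i ∨ 2 * r i < |x|
      rw [one_mul]
      by_contra! h'
      exact h h'
    have hterm (i : ℕ) : (1 + |x|) * |a i| ≤ 3 * C := by
      by_cases hi : a i = 0
      · rw [hi]; simpa using hC0
      obtain ⟨-, h2⟩ := hannulus hi
      have hinv : (r i)⁻¹ ^ k ≤ (r i)⁻¹ :=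
        pow_le_of_le_one (inv_nonneg.2 (hr0 i).le) (inv_le_one_of_one_le₀ (hr1 i)) hk
      calc (1 + |x|) * |a i| ≤ (3 * r i) * ((r i)⁻¹ * C) := by
            rw [ha, abs_mul, abs_of_nonneg (pow_nonneg (inv_nonneg.2 (hr0 i).le) k)]
            refine mul_le_mul (by linarith [hr1 i])
              (mul_le_mul hinv (hC k hk hkn _) (abs_nonneg _) (inv_nonneg.2 (hr0 i).le))
              (mul_nonneg (pow_nonneg (inv_nonneg.2 (hr0 i).le) k) (abs_nonneg _))
              (by linarith [hr0 i])
        _ = 3 * C := by have := (hr0 i).ne'; field_simp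
    have htotal : (1 + |x|) * |∑ i ∈ Finset.range N, a i| ≤ 3 * C := by
      by_cases h : ∃ i ∈ Finset.range N, a i ≠ 0
      · obtain ⟨i, hiN, hi⟩ := h
        rw [Finset.sum_eq_single_of_mem i hiN fun j _ hji => ?_]
        · exact hterm i
        by_contra hj
        have h1 := hannulus hi
        have h2 := hannulus hj
        rcases lt_or_gt_of_ne hji with hlt | hlt
        · linarith [hrlt hlt, hr0 j]
        · linarith [hrlt hlt, hr0 i]
      · push Not at h
        rw [Finset.sum_eq_zero h]; simpa using hC0
    rw [hsum, abs_mul, abs_of_pos (inv_pos.2 hN0)]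
    calc (1 + |x|) * ((N : ℝ)⁻¹ * |∑ i ∈ Finset.range N, a i|)
        = ((1 + |x|) * |∑ i ∈ Finset.range N, a i|) / N := by ring
      _ ≤ 3 * C / N := by gcongr
      _ ≤ ε := by
        rw [div_lt_iff₀ hε] at hN
        rw [div_le_iff₀ hN0]
        linarith

/-- Multiplying by a slowly varying cutoff increases the derivative bounds only slightly. -/
theorem abs_iteratedDeriv_mul_cutoff_le {φ χ : ℝ → ℝ} {n k : ℕ} {ε x : ℝ} (hε : 0 ≤ ε)
    (hkn : k ≤ n) (hφ : ContDiff ℝ n φ) (hχ : ContDiff ℝ ∞ χ)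
    (hφb : ∀ i ≤ n, |iteratedDeriv i φ x| ≤ 1 + |x|) (hφk : |iteratedDeriv k φ x| ≤ 1)
    (hχ0 : 0 ≤ χ x) (hχ1 : χ x ≤ 1)
    (hχb : ∀ i, i ≠ 0 → i ≤ n → (1 + |x|) * |iteratedDeriv i χ x| ≤ ε / 2 ^ n) :
    |iteratedDeriv k (fun y => φ y * χ y) x| ≤ 1 + ε := by
  rw [iteratedDeriv_fun_mul (hφ.of_le (by exact_mod_cast hkn)).contDiffAt
    (hχ.of_le (by exact_mod_cast le_top)).contDiffAt, Finset.sum_range_succ, add_comm]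
  refine (abs_add_le _ _).trans (add_le_add ?_ ?_)
  · simp only [Nat.choose_self, Nat.cast_one, one_mul, Nat.sub_self, iteratedDeriv_zero]
    rw [abs_mul, abs_of_nonneg hχ0]
    exact mul_le_one₀ hφk hχ0 hχ1
  · calc |∑ i ∈ Finset.range k,
            (k.choose i : ℝ) * iteratedDeriv i φ x * iteratedDeriv (k - i) χ x|
        ≤ ∑ i ∈ Finset.range k,
            |(k.choose i : ℝ) * iteratedDeriv i φ x * iteratedDeriv (k - i) χ x| :=
          Finset.abs_sum_le_sum_abs _ _
      _ ≤ ∑ i ∈ Finset.range k, (k.choose i : ℝ) * (ε / 2 ^ n) := by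
          refine Finset.sum_le_sum fun i hi => ?_
          have hik := Finset.mem_range.1 hi
          rw [abs_mul, abs_mul, Nat.abs_cast, mul_assoc]
          refine mul_le_mul_of_nonneg_left ?_ (Nat.cast_nonneg _)
          refine (mul_le_mul_of_nonneg_right (hφb i (by omega)) (abs_nonneg _)).trans ?_
          exact hχb (k - i) (by omega) (by omega)
      _ ≤ ∑ i ∈ Finset.range (k + 1), (k.choose i : ℝ) * (ε / 2 ^ n) :=
          Finset.sum_le_sum_of_subset_of_nonneg
            (Finset.range_mono k.le_succ) fun i _ _ => by positivity
      _ = 2 ^ k * (ε / 2 ^ n) := by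
          rw [← Finset.sum_mul]
          congr 1
          exact_mod_cast Nat.sum_range_choose k
      _ ≤ 2 ^ n * (ε / 2 ^ n) := by gcongr; norm_num
      _ = ε := by field_simp

/-- Test functions of order `p ≤ 1` and at most affine growth can be approximated, locally
uniformly and with uniform domination, by smooth compactly supported ones. -/
theorem exists_contDiff_hasCompactSupport_approx {n p : ℕ} (hn : 1 ≤ n) (hp : p ≤ 1) {φ : ℝ → ℝ}
    (hφ : ContDiff ℝ n φ) (hφb : ∀ k, p ≤ k → k ≤ n → ∀ x, |iteratedDeriv k φ x| ≤ 1)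
    (hφ0 : ∀ x, |φ x| ≤ 1 + |x|) {ε : ℝ} (hε : 0 < ε) (R : ℝ) :
    ∃ ψ : ℝ → ℝ, (∀ k, p ≤ k → k ≤ n → ∀ x, |iteratedDeriv k ψ x| ≤ 1) ∧ ContDiff ℝ ∞ ψ ∧
      HasCompactSupport ψ ∧ (∀ x, |ψ x| ≤ |φ x| + ε) ∧
      ∀ x, |x| ≤ R → |ψ x - φ x| ≤ ε * (1 + |φ x|) := by
  obtain ⟨χ, hχ, hχc, hχ0, hχ1, hχR, hχb⟩ :=
    exists_contDiff_cutoff n (show 0 < ε / 2 ^ n by positivity) R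
  set g : ℝ → ℝ := fun x => φ x * χ x with hg_def
  have hg : ContDiff ℝ n g := hφ.mul (hχ.of_le (by exact_mod_cast le_top))
  have hgc : HasCompactSupport g := hχc.mul_left
  have hφ' (i : ℕ) (hi : i ≤ n) (x : ℝ) : |iteratedDeriv i φ x| ≤ 1 + |x| := by
    rcases Nat.eq_zero_or_pos i with rfl | hi0
    · simpa using hφ0 x
    · linarith [hφb i (by omega) hi x, abs_nonneg x]
  have hgb (k : ℕ) (hpk : p ≤ k) (hkn : k ≤ n) (x : ℝ) : |iteratedDeriv k g x| ≤ 1 + ε :=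
    abs_iteratedDeriv_mul_cutoff_le hε.le hkn hφ hχ (fun i hi => hφ' i hi x) (hφb k hpk hkn x)
      (hχ0 x) (hχ1 x) fun i hi hin => hχb i hi hin x
  have hgφ (x : ℝ) : |g x| ≤ |φ x| := by
    rw [hg_def, abs_mul, abs_of_nonneg (hχ0 x)]
    exact mul_le_of_le_one_right (abs_nonneg _) (hχ1 x)
  let ρ : ContDiffBump (0 : ℝ) := ⟨ε / 2, ε, by positivity, by linarith⟩
  set f : ℝ → ℝ := ρ.normed volume with hf_def
  have hf : LocallyIntegrable f := ρ.integrable_normed.locallyIntegrable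
  set h : ℝ → ℝ := f ⋆[ContinuousLinearMap.lsmul ℝ ℝ] g with hh_def
  have hhc : HasCompactSupport h :=
    HasCompactSupport.convolution (ContinuousLinearMap.lsmul ℝ ℝ) ρ.hasCompactSupport_normed hgc
  have hhb (k : ℕ) (hpk : p ≤ k) (hkn : k ≤ n) (x : ℝ) : |iteratedDeriv k h x| ≤ 1 + ε := by
    have hgk : ContDiff ℝ k g := hg.of_le (by exact_mod_cast hkn)
    rw [hh_def, hgc.iteratedDeriv_convolution_right hf hgk]
    have := dist_convolution_le (μ := volume) (f := f) (g := iteratedDeriv k g) (x₀ := x)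
      (z₀ := 0) (ε := 1 + ε) (R := ε) (by linarith) ρ.support_normed_eq.subset ρ.nonneg_normed
      ρ.integral_normed (hgk.continuous_iteratedDeriv' k).aestronglyMeasurable
      fun y _ => by simpa using hgb k hpk hkn y
    simpa using this
  have hgh (x : ℝ) : |h x - g x| ≤ (1 + ε) * ε := by
    refine ρ.dist_normed_convolution_le hg.continuous.aestronglyMeasurable fun y hy => ?_
    have hL := Convex.norm_image_sub_le_of_norm_deriv_le (f := g) (s := Set.univ) (x := x) (y := y)
      (C := 1 + ε) (fun z _ => (hg.differentiable (by exact_mod_cast (by omega))) z)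
      (fun z _ => by simpa [iteratedDeriv_one] using hgb 1 hp hn z) convex_univ trivial trivial
    refine hL.trans (mul_le_mul_of_nonneg_left ?_ (by linarith))
    exact (mem_ball_iff_norm.1 hy).le
  have hc : 0 < 1 + ε := by linarith
  have hsplit (x : ℝ) : |(1 + ε)⁻¹ * h x - (1 + ε)⁻¹ * g x| ≤ ε := by
    rw [← mul_sub, abs_mul, abs_of_pos (inv_pos.2 hc), ← div_eq_inv_mul, div_le_iff₀' hc]
    exact hgh x
  refine ⟨fun x => (1 + ε)⁻¹ * h x, fun k hpk hkn x => ?_, contDiff_const.mul ?_, ?_,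
    fun x => ?_, fun x hx => ?_⟩
  · rw [iteratedDeriv_const_mul_field, abs_mul, abs_of_pos (inv_pos.2 hc), ← div_eq_inv_mul,
      div_le_one hc]
    exact hhb k hpk hkn x
  · exact ρ.hasCompactSupport_normed.contDiff_convolution_left _ ρ.contDiff_normed
      hg.continuous.locallyIntegrable
  · exact hhc.mul_left (f := fun _ => (1 + ε)⁻¹)
  · have h1 : |(1 + ε)⁻¹ * g x| ≤ |φ x| := by
      rw [abs_mul, abs_of_pos (inv_pos.2 hc)]
      exact (mul_le_of_le_one_left (abs_nonneg _)
        (inv_le_one_of_one_le₀ (by linarith))).trans (hgφ x)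
    linarith [abs_sub_abs_le_abs_sub ((1 + ε)⁻¹ * h x) ((1 + ε)⁻¹ * g x), hsplit x]
  · have hgx : g x = φ x := by rw [hg_def]; simp [hχR x hx]
    have h1 : |(1 + ε)⁻¹ * g x - φ x| ≤ ε * |φ x| := by
      have : (1 + ε)⁻¹ * g x - φ x = -((1 + ε)⁻¹ * (ε * φ x)) := by rw [hgx]; field_simp; ring
      rw [this, abs_neg, abs_mul, abs_mul, abs_of_pos (inv_pos.2 hc), abs_of_pos hε]
      exact mul_le_of_le_one_left (by positivity) (inv_le_one_of_one_le₀ (by linarith))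
    linarith [abs_sub_le ((1 + ε)⁻¹ * h x) ((1 + ε)⁻¹ * g x) (φ x), hsplit x]

end SmoothApproximation

/-- **Lemma A.3.** For `1 ≤ n`, `p ∈ {0,1}`, and real random variables `X, Y` with
finite moments of order `p`, the smooth distance built from test functions in
`B_{p,n}` (all derivatives of orders `p,…,n` bounded by `1`) equals the one built from
`B_{p,n} ∩ C_c^∞(ℝ)` (smooth compactly supported test functions); the suprema of
`E[φ(X)] − E[φ(Y)]` are taken in `[0,∞]`, over test functions for which both
expectations exist. -/
theorem smooth_distance_eq_smooth_distance_Ccinfty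
    {Ω : Type*} [MeasureSpace Ω] [IsProbabilityMeasure (ℙ : Measure Ω)]
    (n p : ℕ) (hn : 1 ≤ n) (hp : p = 0 ∨ p = 1)
    (X Y : Ω → ℝ) (hX : Measurable X) (hY : Measurable Y)
    (hXp : Integrable (fun ω => |X ω| ^ p) ℙ)
    (hYp : Integrable (fun ω => |Y ω| ^ p) ℙ) :
    (⨆ φ ∈ {φ : ℝ → ℝ |
        (ContDiff ℝ n φ ∧ ∀ k, p ≤ k → k ≤ n → ∀ x, |iteratedDeriv k φ x| ≤ 1) ∧
        Integrable (fun ω => φ (X ω)) ℙ ∧ Integrable (fun ω => φ (Y ω)) ℙ},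
      ENNReal.ofReal ((∫ ω, φ (X ω)) - ∫ ω, φ (Y ω))) =
    (⨆ φ ∈ {φ : ℝ → ℝ |
        ((ContDiff ℝ n φ ∧ ∀ k, p ≤ k → k ≤ n → ∀ x, |iteratedDeriv k φ x| ≤ 1) ∧
          ContDiff ℝ ((⊤ : ℕ∞) : WithTop ℕ∞) φ ∧ HasCompactSupport φ) ∧
        Integrable (fun ω => φ (X ω)) ℙ ∧ Integrable (fun ω => φ (Y ω)) ℙ},
      ENNReal.ofReal ((∫ ω, φ (X ω)) - ∫ ω, φ (Y ω))) := by
  have hp1 : p ≤ 1 := by omega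
  refine le_antisymm (iSup₂_le fun φ hφ => ?_)
    (biSup_mono fun φ hφ => ⟨hφ.1.1, hφ.2⟩)
  obtain ⟨⟨hφC, hφb⟩, hφX, hφY⟩ := hφ
  obtain ⟨φ₀, hφ₀C, hφ₀b, hφ₀0, hφ₀X, hφ₀Y, hEq⟩ : ∃ φ₀ : ℝ → ℝ, ContDiff ℝ n φ₀ ∧
      (∀ k, p ≤ k → k ≤ n → ∀ x, |iteratedDeriv k φ₀ x| ≤ 1) ∧ (∀ x, |φ₀ x| ≤ 1 + |x|) ∧
      Integrable (fun ω => φ₀ (X ω)) ℙ ∧ Integrable (fun ω => φ₀ (Y ω)) ℙ ∧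
      (∫ ω, φ (X ω)) - ∫ ω, φ (Y ω) = (∫ ω, φ₀ (X ω)) - ∫ ω, φ₀ (Y ω) := by
    rcases hp with rfl | rfl
    · refine ⟨φ, hφC, hφb, fun x => ?_, hφX, hφY, rfl⟩
      have := hφb 0 le_rfl (Nat.zero_le _) x
      rw [iteratedDeriv_zero] at this
      linarith [abs_nonneg x]
    · refine ⟨fun x => -φ 0 + φ x, contDiff_const.add hφC, fun k hk hkn x => ?_, fun x => ?_,
        (integrable_const _).add hφX, (integrable_const _).add hφY, ?_⟩
      · rw [iteratedDeriv_const_add (by omega)]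
        exact hφb k hk hkn x
      · have hL := Convex.norm_image_sub_le_of_norm_deriv_le (f := φ) (s := Set.univ) (x := 0)
          (y := x) (C := 1) (fun z _ => (hφC.differentiable (by exact_mod_cast (by omega))) z)
          (fun z _ => by simpa [iteratedDeriv_one] using hφb 1 le_rfl hn z)
          convex_univ trivial trivial
        rw [sub_zero, one_mul, Real.norm_eq_abs, Real.norm_eq_abs] at hL
        change |-φ 0 + φ x| ≤ 1 + |x|
        rw [neg_add_eq_sub]
        linarith
      · rw [integral_add (integrable_const _) hφX, integral_add (integrable_const _) hφY]
        ring
  have hε (m : ℕ) : (0 : ℝ) < 1 / ((m : ℝ) + 1) := by positivity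
  choose ψ hψb hψC hψc hψle hψφ using fun m : ℕ =>
    exists_contDiff_hasCompactSupport_approx hn hp1 hφ₀C hφ₀b hφ₀0 (hε m) m
  have hψ1 (m : ℕ) (x : ℝ) : ‖ψ m x‖ ≤ |φ₀ x| + 1 :=
    (hψle m x).trans (add_le_add_right
      ((div_le_one (by positivity)).2 (by linarith [(Nat.cast_nonneg m : (0 : ℝ) ≤ m)])) _)
  have hψlim (x : ℝ) : Tendsto (fun m => ψ m x) atTop (𝓝 (φ₀ x)) := by
    rw [tendsto_iff_dist_tendsto_zero]
    have hlim : Tendsto (fun m : ℕ => 1 / ((m : ℝ) + 1) * (1 + |φ₀ x|)) atTop (𝓝 0) := by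
      simpa using tendsto_one_div_add_atTop_nhds_zero_nat.mul_const (1 + |φ₀ x|)
    refine squeeze_zero' (Eventually.of_forall fun _ => dist_nonneg) ?_ hlim
    filter_upwards [eventually_ge_atTop ⌈|x|⌉₊] with m hm
    exact hψφ m x ((Nat.le_ceil _).trans (by exact_mod_cast hm))
  have hmeas (m : ℕ) {Z : Ω → ℝ} (hZ : Measurable Z) :
      AEStronglyMeasurable (fun ω => ψ m (Z ω)) ℙ :=
    ((hψC m).continuous.measurable.comp hZ).aestronglyMeasurable
  have hdom {Z : Ω → ℝ} (hZ : Integrable (fun ω => φ₀ (Z ω)) ℙ) :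
      Integrable (fun ω => |φ₀ (Z ω)| + 1) ℙ := hZ.abs.add (integrable_const _)
  have hint {Z : Ω → ℝ} (hZ : Measurable Z) (hφZ : Integrable (fun ω => φ₀ (Z ω)) ℙ) :
      Tendsto (fun m => ∫ ω, ψ m (Z ω)) atTop (𝓝 (∫ ω, φ₀ (Z ω))) :=
    tendsto_integral_of_dominated_convergence _ (fun m => hmeas m hZ) (hdom hφZ)
      (fun m => Eventually.of_forall fun ω => hψ1 m (Z ω))
      (Eventually.of_forall fun ω => hψlim (Z ω))
  rw [hEq]
  refine le_of_tendsto
    (ENNReal.tendsto_ofReal ((hint hX hφ₀X).sub (hint hY hφ₀Y)))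
    (Eventually.of_forall fun m => ?_)
  exact le_iSup₂_of_le (ψ m) ⟨⟨⟨(hψC m).of_le (by exact_mod_cast le_top), hψb m⟩, hψC m, hψc m⟩,
    (hdom hφ₀X).mono' (hmeas m hX) (Eventually.of_forall fun ω => hψ1 m (X ω)),
    (hdom hφ₀Y).mono' (hmeas m hY) (Eventually.of_forall fun ω => hψ1 m (Y ω))⟩ le_rfl
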